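/- arXiv:1711.11202 — 2 statements merged into one kernel-verified Lean document; each statement's English description precedes it below -/
import Mathlib

section
/- Let q be a prime power, m, n positive integers with n ≤ m, g_1, …, g_n ∈ F_{q^m} linearly independent over F_q, and 1 ≤ k ≤ n. Let f be a monic q-linearized polynomial over F_{q^m} with k ≤ deg_q(f) < n and let σ_f = (f(g_1), …, f(g_n)). Then d_H(σ_f, G) = n − deg_q(f) if and only if there exist a subset E = {g_{i_1}, …, g_{i_{deg_q(f)}}} of {g_1, …, g_n} of size deg_q(f) and a q-linearized polynomial v over F_{q^m} with deg_q(v) ≤ k − 1 such that f(x) − v(x) = ∏_{g ∈ ⟨E⟩} (x − g), where ⟨E⟩ is the F_q-span of E. -/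
open Polynomial

def gabidulinCode (q : ℕ) {F : Type} [Field F] {n : ℕ} (g : Fin n → F) (k : ℕ) :
    Set (Fin n → F) :=
  {c | ∃ v : Fin k → F, c = fun j => ∑ i : Fin k, v i * g j ^ q ^ (i : ℕ)}

noncomputable def hammingDistTo {F : Type} [DecidableEq F] {n : ℕ}
    (u : Fin n → F) (G : Set (Fin n → F)) : ℕ :=
  sInf {r : ℕ | ∃ c ∈ G, r = hammingDist u c}

noncomputable def linearizedPoly (q : ℕ) {F : Type} [Field F] (N : ℕ) (c : ℕ → F) :
    Polynomial F :=
  ∑ i ∈ Finset.range N, C (c i) * X ^ q ^ i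

section LinearizedPoly

variable {Fq F : Type} [Field Fq] [Fintype Fq] [Field F] [Algebra Fq F]

theorem linearizedPoly_eval (q : ℕ) (N : ℕ) (c : ℕ → F) (x : F) :
    (linearizedPoly q N c).eval x = ∑ i ∈ Finset.range N, c i * x ^ q ^ i := by
  simp [linearizedPoly, eval_finsetSum]

theorem linearizedPoly_sub (q : ℕ) (N : ℕ) (a b : ℕ → F) :
    linearizedPoly q N a - linearizedPoly q N b = linearizedPoly q N (a - b) := by
  simp [linearizedPoly, sub_mul]

theorem linearizedPoly_eq_of_le (q : ℕ) {k N : ℕ} (hkN : k ≤ N) (b : ℕ → F)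
    (hb : ∀ i, k ≤ i → b i = 0) : linearizedPoly q k b = linearizedPoly q N b := by
  refine Finset.sum_subset (Finset.range_subset_range.2 hkN) fun i _ hi => ?_
  rw [hb i (by simpa using hi), C_0, zero_mul]

theorem degree_linearizedPoly_lt {q : ℕ} (hq : 1 < q) (N : ℕ) (c : ℕ → F) :
    (linearizedPoly q N c).degree < (q ^ N : ℕ) := by
  rw [← mem_degreeLT]
  refine Submodule.sum_mem _ fun i hi => mem_degreeLT.2 ?_
  refine (degree_C_mul_X_pow_le _ _).trans_lt ?_
  exact_mod_cast Nat.pow_lt_pow_right hq (Finset.mem_range.1 hi)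

theorem linearizedPoly_succ {q N : ℕ} {c : ℕ → F} (hc : c N = 1) :
    linearizedPoly q (N + 1) c = X ^ q ^ N + linearizedPoly q N c := by
  rw [linearizedPoly, Finset.sum_range_succ, hc, C_1, one_mul, add_comm, linearizedPoly]

theorem linearizedPoly_monic {q : ℕ} (hq : 1 < q) {N : ℕ} {c : ℕ → F} (hc : c N = 1) :
    (linearizedPoly q (N + 1) c).Monic := by
  rw [linearizedPoly_succ hc]
  exact monic_X_pow_add (degree_linearizedPoly_lt hq N c)

theorem natDegree_linearizedPoly {q : ℕ} (hq : 1 < q) {N : ℕ} {c : ℕ → F} (hc : c N = 1) :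
    (linearizedPoly q (N + 1) c).natDegree = q ^ N := by
  rw [linearizedPoly_succ hc, natDegree_add_eq_left_of_degree_lt, natDegree_X_pow]
  rw [degree_X_pow]
  exact degree_linearizedPoly_lt hq N c

theorem linearizedPoly_eval_eq_zero_of_mem_span {q : ℕ} (hq : Fintype.card Fq = q) (N : ℕ)
    (c : ℕ → F) {S : Set F} (hS : ∀ x ∈ S, (linearizedPoly q N c).eval x = 0) {x : F}
    (hx : x ∈ Submodule.span Fq S) : (linearizedPoly q N c).eval x = 0 := by
  let φ : F →ₗ[Fq] F := ∑ i ∈ Finset.range N,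
    LinearMap.mulLeft Fq (c i) ∘ₗ ((FiniteField.frobeniusAlgHom Fq F) ^ i).toLinearMap
  have hφ (y : F) : φ y = (linearizedPoly q N c).eval y := by
    simp [φ, linearizedPoly_eval, ← hq, AlgHom.coe_pow,
      FiniteField.coe_frobeniusAlgHom, pow_iterate]
  rw [← hφ]
  have hle : Submodule.span Fq S ≤ LinearMap.ker φ :=
    Submodule.span_le.2 fun y hy => by simpa [hφ] using hS y hy
  exact hle hx

theorem card_toFinset_span_image {n : ℕ} {g : Fin n → F} (hg : LinearIndependent Fq g)
    (s : Finset (Fin n)) [Fintype (Submodule.span Fq (g '' (s : Set (Fin n))) : Set F)] :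
    ((Submodule.span Fq (g '' (s : Set (Fin n)))) : Set F).toFinset.card
      = Fintype.card Fq ^ s.card := by
  classical
  have hfin := finrank_span_finset_eq_card (R := Fq) (s := s.image g) (by
    rw [Finset.coe_image]; exact (hg.linearIndepOn (s : Set (Fin n))).id_image)
  rw [Finset.card_image_of_injective _ hg.injective, Finset.coe_image] at hfin
  rw [Set.toFinset_card, ← hfin, ← Nat.card_eq_fintype_card, ← Nat.card_eq_fintype_card]
  exact Module.natCard_eq_pow_finrank

theorem prod_X_sub_C_span_dvd {q : ℕ} (hq : Fintype.card Fq = q) (N : ℕ) (c : ℕ → F) {S : Set F}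
    [Fintype (Submodule.span Fq S : Set F)]
    (hS : ∀ x ∈ S, (linearizedPoly q N c).eval x = 0) :
    ∏ h ∈ ((Submodule.span Fq S) : Set F).toFinset, (X - C h) ∣ linearizedPoly q N c := by
  refine Finset.prod_dvd_of_coprime
    (fun x _ y _ hxy => pairwise_coprime_X_sub_C Function.injective_id hxy) fun x hx => ?_
  rw [dvd_iff_isRoot]
  exact linearizedPoly_eval_eq_zero_of_mem_span hq N c hS (by simpa using hx)

theorem card_le_of_linearizedPoly_eval_eq_zero {q : ℕ} (hq : Fintype.card Fq = q) {N : ℕ}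
    {c : ℕ → F} (hc : c N = 1) {n : ℕ} {g : Fin n → F} (hg : LinearIndependent Fq g)
    {s : Finset (Fin n)} (hs : ∀ j ∈ s, (linearizedPoly q (N + 1) c).eval (g j) = 0) :
    s.card ≤ N := by
  have hq1 : 1 < q := hq ▸ Fintype.one_lt_card
  have : Finite (Submodule.span Fq (g '' (s : Set (Fin n)))) :=
    have := FiniteDimensional.span_of_finite Fq (s.finite_toSet.image g)
    Module.finite_of_finite Fq
  have := Fintype.ofFinite (Submodule.span Fq (g '' (s : Set (Fin n))) : Set F)
  have hdvd := prod_X_sub_C_span_dvd hq (N + 1) c (S := g '' (s : Set (Fin n)))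
    (by rintro _ ⟨j, hj, rfl⟩; exact hs j hj)
  have hle := natDegree_le_of_dvd hdvd (linearizedPoly_monic hq1 hc).ne_zero
  rw [natDegree_finsetProd_X_sub_C_eq_card, card_toFinset_span_image hg, hq,
    natDegree_linearizedPoly hq1 hc] at hle
  exact (Nat.pow_le_pow_iff_right hq1).1 hle

theorem prod_X_sub_C_span_eq {q : ℕ} (hq : Fintype.card Fq = q) {N : ℕ}
    {c : ℕ → F} (hc : c N = 1) {n : ℕ} {g : Fin n → F} (hg : LinearIndependent Fq g)
    {s : Finset (Fin n)} (hs : ∀ j ∈ s, (linearizedPoly q (N + 1) c).eval (g j) = 0)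
    (hcard : s.card = N) [Fintype (Submodule.span Fq (g '' (s : Set (Fin n))) : Set F)] :
    linearizedPoly q (N + 1) c =
      ∏ h ∈ ((Submodule.span Fq (g '' (s : Set (Fin n)))) : Set F).toFinset, (X - C h) := by
  have hq1 : 1 < q := hq ▸ Fintype.one_lt_card
  refine eq_of_monic_of_dvd_of_natDegree_le (monic_prod_of_monic _ _ fun h _ => monic_X_sub_C h)
    (linearizedPoly_monic hq1 hc) (prod_X_sub_C_span_dvd hq (N + 1) c ?_) ?_
  · rintro _ ⟨j, hj, rfl⟩
    exact hs j hj
  · rw [natDegree_finsetProd_X_sub_C_eq_card, card_toFinset_span_image hg, hq, hcard,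
      natDegree_linearizedPoly hq1 hc]

end LinearizedPoly

theorem hammingDist_eq_sub_card_agree {F : Type} [DecidableEq F] {n : ℕ} (u c : Fin n → F) :
    hammingDist u c = n - (Finset.univ.filter fun j => u j = c j).card := by
  have h := Finset.card_filter_add_card_filter_not (s := (Finset.univ : Finset (Fin n)))
    (fun j => u j = c j)
  rw [Finset.card_univ, Fintype.card_fin] at h
  rw [hammingDist]
  simp only [ne_eq]
  omega

theorem mem_gabidulinCode_iff (q : ℕ) {F : Type} [Field F] {n : ℕ} (g : Fin n → F) (k : ℕ)
    (c : Fin n → F) :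
    c ∈ gabidulinCode q g k ↔
      ∃ b : ℕ → F, (∀ i, k ≤ i → b i = 0) ∧ c = fun j => (linearizedPoly q k b).eval (g j) := by
  simp only [linearizedPoly_eval]
  constructor
  · rintro ⟨v, rfl⟩
    refine ⟨fun i => if h : i < k then v ⟨i, h⟩ else 0, fun i hi => dif_neg hi.not_gt, ?_⟩
    funext j
    simp [Finset.sum_range]
  · rintro ⟨b, -, rfl⟩
    exact ⟨fun i => b i, by simp [Finset.sum_range]⟩

open scoped Classical in
/-- Theorem 2 (equality case, Hamming metric): for monic `f` with `k ≤ deg_q f = D < n`,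
`d_H(σ_f, G) = n - D` iff `f - v = ∏_{h ∈ ⟨E⟩} (X - h)` for some `D`-element subset
`E` of `{g_1, …, g_n}` and some `q`-linearized `v` of `q`-degree at most `k - 1`. -/
theorem hamming_dist_eq_iff
    (q m n k : ℕ) (hq : IsPrimePow q) (hm : 0 < m) (hn : 0 < n) (hnm : n ≤ m)
    (Fq F : Type) [Field Fq] [Fintype Fq] [Field F] [Fintype F] [DecidableEq F] [Algebra Fq F]
    (hcardFq : Fintype.card Fq = q) (hcardF : Fintype.card F = q ^ m)
    (g : Fin n → F) (hg : LinearIndependent Fq g)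
    (hk : 1 ≤ k) (hkn : k ≤ n)
    (D : ℕ) (hkD : k ≤ D) (hDn : D < n)
    (a : ℕ → F) (haD : a D = 1) (htop : ∀ i, D < i → a i = 0)
    (f : Polynomial F) (hf : f = ∑ i ∈ Finset.range (D + 1), C (a i) * X ^ q ^ i)
    (σf : Fin n → F)
    (hσf : σf = fun j => ∑ i ∈ Finset.range (D + 1), a i * g j ^ q ^ i) :
    hammingDistTo σf (gabidulinCode q g k) = n - D ↔
      ∃ s : Finset (Fin n), s.card = D ∧
        ∃ b : ℕ → F, (∀ i, k ≤ i → b i = 0) ∧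
          f - (∑ i ∈ Finset.range k, C (b i) * X ^ q ^ i) =
            ∏ h ∈ ((Submodule.span Fq (g '' (s : Set (Fin n)))) : Set F).toFinset,
              (X - C h) := by
  have hsub (b : ℕ → F) (hb : ∀ i, k ≤ i → b i = 0) :
      f - linearizedPoly q k b = linearizedPoly q (D + 1) (a - b) := by
    rw [linearizedPoly_eq_of_le q (hkD.trans D.le_succ) b hb, ← linearizedPoly_sub, hf]
    rfl
  have hlead (b : ℕ → F) (hb : ∀ i, k ≤ i → b i = 0) : (a - b) D = 1 := by
    simp [haD, hb D hkD]
  have hσ (j : Fin n) : σf j = f.eval (g j) := by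
    rw [hσf, hf]
    exact (linearizedPoly_eval q (D + 1) a (g j)).symm
  have hagree (b : ℕ → F) (hb : ∀ i, k ≤ i → b i = 0) (j : Fin n) :
      σf j = (linearizedPoly q k b).eval (g j) ↔
        (linearizedPoly q (D + 1) (a - b)).eval (g j) = 0 := by
    rw [← hsub b hb, eval_sub, sub_eq_zero, hσ]
  have hlow (b : ℕ → F) (hb : ∀ i, k ≤ i → b i = 0) :
      (Finset.univ.filter fun j => σf j = (linearizedPoly q k b).eval (g j)).card ≤ D :=
    card_le_of_linearizedPoly_eval_eq_zero hcardFq (hlead b hb) hg fun j hj =>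
      (hagree b hb j).1 (Finset.mem_filter.1 hj).2
  have hne : {r : ℕ | ∃ c ∈ gabidulinCode q g k, r = hammingDist σf c}.Nonempty :=
    ⟨_, _, (mem_gabidulinCode_iff q g k _).2 ⟨0, fun _ _ => rfl, rfl⟩, rfl⟩
  constructor
  · intro hd
    obtain ⟨c, hc, hr⟩ := Nat.sInf_mem hne
    obtain ⟨b, hb, rfl⟩ := (mem_gabidulinCode_iff q g k c).1 hc
    rw [hammingDist_eq_sub_card_agree] at hr
    have hlow' := hlow b hb
    refine ⟨Finset.univ.filter fun j => σf j = (linearizedPoly q k b).eval (g j), ?_, b, hb, ?_⟩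
    · rw [hammingDistTo] at hd
      omega
    · refine (hsub b hb).trans (prod_X_sub_C_span_eq hcardFq (hlead b hb) hg (fun j hj =>
        (hagree b hb j).1 (Finset.mem_filter.1 hj).2) ?_)
      rw [hammingDistTo] at hd
      omega
  · rintro ⟨s, hs, b, hb, hprod⟩
    apply le_antisymm
    · have hle : hammingDistTo σf (gabidulinCode q g k) ≤ hammingDist σf _ :=
        Nat.sInf_le ⟨_, (mem_gabidulinCode_iff q g k _).2 ⟨b, hb, rfl⟩, rfl⟩
      refine hle.trans ?_
      rw [hammingDist_eq_sub_card_agree, ← hs]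
      refine Nat.sub_le_sub_left (Finset.card_le_card fun j hj => ?_) n
      refine Finset.mem_filter.2 ⟨Finset.mem_univ j, (hagree b hb j).2 ?_⟩
      rw [← hsub b hb, linearizedPoly, hprod, eval_prod]
      refine Finset.prod_eq_zero (i := g j) ?_ (by simp)
      exact Set.mem_toFinset.2 (Submodule.subset_span ⟨j, hj, rfl⟩)
    · refine le_csInf hne ?_
      rintro r ⟨c, hc, rfl⟩
      obtain ⟨b, hb, rfl⟩ := (mem_gabidulinCode_iff q g k c).1 hc
      rw [hammingDist_eq_sub_card_agree]
      exact Nat.sub_le_sub_left (hlow b hb) n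
end

section
/- Let q be a prime power, m, n positive integers with n ≤ m, g_1, …, g_n ∈ F_{q^m} linearly independent over F_q, and 1 ≤ k with k + 1 < n. Let f(x) = x^{q^{k+1}} − a_1 x^{q^k} + (terms of q-degree < k) be a monic q-linearized polynomial over F_{q^m} of q-degree k+1, and σ_f = (f(g_1), …, f(g_n)). Then d_R(σ_f, G) = n − (k+1) if and only if there exist k+1 F_q-linearly independent elements β_1, …, β_{k+1} of ⟨g_1, …, g_n⟩ such that a_1 = det(R_k(β_1, …, β_{k+1})) / det(M_{k+1}(β_1, …, β_{k+1})). -/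
noncomputable def rankDistTo (Fq : Type) [Field Fq] {F : Type} [Field F] [Algebra Fq F]
    {n : ℕ} (u : Fin n → F) (G : Set (Fin n → F)) : ℕ :=
  sInf {r : ℕ | ∃ c ∈ G, r = Module.finrank Fq (Submodule.span Fq (Set.range (u - c)))}

/-- The square Moore matrix `M_N(β_1, …, β_N)`, with `(i, j)` entry `β_j ^ (q ^ i)`. -/
def mooreMatrix (q : ℕ) {F : Type} [Field F] {N : ℕ} (β : Fin N → F) :
    Matrix (Fin N) (Fin N) F :=
  Matrix.of fun i j => β j ^ q ^ (i : ℕ)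

/-- The matrix `R_r(β_1, …, β_N)`: the `(N+1) × N` Moore matrix `M_{N+1}(β_1, …, β_N)`
with the row of exponent `q ^ r` deleted. -/
def mooreMatrixDelRow (q r : ℕ) {F : Type} [Field F] {N : ℕ} (β : Fin N → F) :
    Matrix (Fin N) (Fin N) F :=
  Matrix.of fun i j => β j ^ q ^ (if (i : ℕ) < r then (i : ℕ) else (i : ℕ) + 1)

open Polynomial in
/-- The `q`-linearized polynomial with coefficients `b`. -/
noncomputable def linearizedPolynomial (q : ℕ) {F : Type} [Field F] {N : ℕ} (b : Fin N → F) :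
    F[X] :=
  ∑ i : Fin N, C (b i) * X ^ q ^ (i : ℕ)

theorem linearizedPolynomial_ne_zero {q : ℕ} (hq : 1 < q) {F : Type} [Field F] {N : ℕ}
    {b : Fin N → F} (hb : b ≠ 0) : linearizedPolynomial q b ≠ 0 := by
  obtain ⟨i, hi⟩ := Function.ne_iff.mp hb
  intro h
  apply hi
  have hcoeff := congrArg (fun p => p.coeff (q ^ (i : ℕ))) h
  simpa [linearizedPolynomial, Polynomial.finsetSum_coeff, Polynomial.coeff_X_pow,
    Nat.pow_right_injective hq |>.eq_iff, Fin.val_inj] using hcoeff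

theorem natDegree_linearizedPolynomial_lt {q : ℕ} (hq : 1 < q) {F : Type} [Field F] {N : ℕ}
    (b : Fin N → F) : (linearizedPolynomial q b).natDegree < q ^ N := by
  refine Nat.lt_of_le_pred (by positivity) (Polynomial.natDegree_sum_le_of_forall_le _ _ ?_)
  intro i _
  exact (Polynomial.natDegree_C_mul_X_pow_le _ _).trans
    (Nat.le_pred_of_lt (Nat.pow_lt_pow_right hq i.isLt))

/-- The `F_q`-linear map induced by the `q`-linearized polynomial with coefficients `b`. -/
noncomputable def linearizedMap (Fq : Type) [Field Fq] [Fintype Fq] {F : Type} [Field F]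
    [Algebra Fq F] {N : ℕ} (b : Fin N → F) : F →ₗ[Fq] F :=
  ∑ i : Fin N, LinearMap.mulLeft Fq (b i) ∘ₗ
    (FiniteField.frobeniusAlgHom Fq F ^ (i : ℕ)).toLinearMap

section

variable {Fq F : Type} [Field Fq] [Fintype Fq] [Field F] [Algebra Fq F] {N : ℕ}

theorem linearizedMap_apply (b : Fin N → F) (x : F) :
    linearizedMap Fq b x = ∑ i : Fin N, b i * x ^ Fintype.card Fq ^ (i : ℕ) := by
  simp [linearizedMap, AlgHom.coe_pow, FiniteField.coe_frobeniusAlgHom, pow_iterate]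

theorem finrank_ker_linearizedMap_lt [Finite F] {b : Fin N → F} (hb : b ≠ 0) :
    Module.finrank Fq (LinearMap.ker (linearizedMap Fq b)) < N := by
  classical
  have := Fintype.ofFinite F
  have hq : 1 < Fintype.card Fq := Fintype.one_lt_card
  let Z : Finset F := Finset.univ.filter (· ∈ LinearMap.ker (linearizedMap Fq b))
  have hZ : Z.card ≤ (linearizedPolynomial (Fintype.card Fq) b).natDegree := by
    refine Polynomial.card_le_degree_of_subset_roots fun x hx => ?_
    have hx' : linearizedMap Fq b x = 0 := by simpa [Z] using hx
    rw [linearizedMap_apply] at hx'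
    rw [Polynomial.mem_roots (linearizedPolynomial_ne_zero hq hb)]
    simpa [linearizedPolynomial, Polynomial.IsRoot, Polynomial.eval_finsetSum] using hx'
  have hcard : Z.card = Fintype.card Fq ^
      Module.finrank Fq (LinearMap.ker (linearizedMap Fq b)) := by
    rw [← Module.card_eq_pow_finrank, Fintype.card_subtype]
  rw [hcard] at hZ
  exact (Nat.pow_lt_pow_iff_right hq).mp
    (hZ.trans_lt (natDegree_linearizedPolynomial_lt hq b))

theorem vecMul_mooreMatrix (b β : Fin N → F) (j : Fin N) :
    Matrix.vecMul b (mooreMatrix (Fintype.card Fq) β) j = linearizedMap Fq b (β j) := by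
  simp [Matrix.vecMul, dotProduct, mooreMatrix, linearizedMap_apply]

theorem det_mooreMatrix_ne_zero [Finite F] {β : Fin N → F} (hβ : LinearIndependent Fq β) :
    (mooreMatrix (Fintype.card Fq) β).det ≠ 0 := by
  intro h
  obtain ⟨b, hb, hbβ⟩ := Matrix.exists_vecMul_eq_zero_iff.mpr h
  refine (finrank_ker_linearizedMap_lt (Fq := Fq) hb).not_ge ?_
  have hle : Submodule.span Fq (Set.range β) ≤ LinearMap.ker (linearizedMap Fq b) := by
    rw [Submodule.span_le]
    rintro _ ⟨j, rfl⟩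
    simpa [vecMul_mooreMatrix] using congrFun hbβ j
  simpa [finrank_span_eq_card hβ] using Submodule.finrank_mono hle

theorem det_mooreMatrixDelRow {k : ℕ} {β : Fin (k + 1) → F} (b : Fin (k + 1) → F)
    (h : ∀ j, linearizedMap Fq b (β j) = β j ^ Fintype.card Fq ^ (k + 1)) :
    (mooreMatrixDelRow (Fintype.card Fq) k β).det =
      b (Fin.last k) * (mooreMatrix (Fintype.card Fq) β).det := by
  rw [← smul_eq_mul, ← Matrix.det_updateRow_sum]
  congr 1
  ext i j
  induction i using Fin.lastCases with
  | last =>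
    simp only [Matrix.updateRow_self, Finset.sum_apply, Pi.smul_apply, smul_eq_mul]
    simpa [linearizedMap_apply, mooreMatrix, mooreMatrixDelRow] using (h j).symm
  | cast i =>
    simp [mooreMatrix, mooreMatrixDelRow]

/-- The map of the monic linearized polynomial `x^{q^{k+1}} - a x^{q^k} + ∑_{i<k} d_i x^{q^i}`. -/
noncomputable def monicLinearizedMap (Fq : Type) [Field Fq] [Fintype Fq] {F : Type} [Field F]
    [Algebra Fq F] {k : ℕ} (a : F) (d : Fin k → F) : F →ₗ[Fq] F :=
  linearizedMap Fq (Fin.snoc (Fin.snoc d (-a) : Fin (k + 1) → F) 1 : Fin (k + 2) → F)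

theorem monicLinearizedMap_apply {k : ℕ} (a : F) (d : Fin k → F) (x : F) :
    monicLinearizedMap Fq a d x = x ^ Fintype.card Fq ^ (k + 1) -
      a * x ^ Fintype.card Fq ^ k + ∑ i : Fin k, d i * x ^ Fintype.card Fq ^ (i : ℕ) := by
  simp only [monicLinearizedMap, linearizedMap_apply, Fin.sum_univ_castSucc, Fin.snoc_castSucc,
    Fin.snoc_last, Fin.val_castSucc, Fin.val_last]
  ring

theorem finrank_ker_monicLinearizedMap_le [Finite F] {k : ℕ} (a : F) (d : Fin k → F) :
    Module.finrank Fq (LinearMap.ker (monicLinearizedMap Fq a d)) ≤ k + 1 := by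
  refine Nat.le_of_lt_succ (finrank_ker_linearizedMap_lt fun h => ?_)
  simpa using congrFun h (Fin.last (k + 1))

/-- Linearly independent `β` are roots of some monic linearized polynomial of `q`-degree `k + 1`
with second coefficient `-a` exactly when `a` is the quotient of Moore determinants. -/
theorem exists_monicLinearizedMap_eq_zero_iff [Finite F] {k : ℕ} {β : Fin (k + 1) → F}
    (hβ : LinearIndependent Fq β) (a : F) :
    (∃ d : Fin k → F, ∀ j, monicLinearizedMap Fq a d (β j) = 0) ↔
      a = (mooreMatrixDelRow (Fintype.card Fq) k β).det /
        (mooreMatrix (Fintype.card Fq) β).det := by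
  have hdet := det_mooreMatrix_ne_zero hβ
  rw [eq_div_iff hdet]
  constructor
  · rintro ⟨d, hd⟩
    have h := det_mooreMatrixDelRow (Fq := Fq) (β := β) (Fin.snoc (-d) a) fun j => ?_
    · simpa using h.symm
    · have := hd j
      rw [monicLinearizedMap_apply] at this
      simp only [linearizedMap_apply, Fin.sum_univ_castSucc, Fin.snoc_castSucc, Fin.snoc_last,
        Fin.val_castSucc, Fin.val_last, Pi.neg_apply, neg_mul, Finset.sum_neg_distrib]
      linear_combination -this
  · intro ha
    let M := mooreMatrix (Fintype.card Fq) β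
    let b := Matrix.vecMul (fun j => β j ^ Fintype.card Fq ^ (k + 1)) M⁻¹
    have hb (j) : linearizedMap Fq b (β j) = β j ^ Fintype.card Fq ^ (k + 1) := by
      rw [← vecMul_mooreMatrix, Matrix.vecMul_vecMul,
        Matrix.nonsing_inv_mul _ (isUnit_iff_ne_zero.mpr hdet), Matrix.vecMul_one]
    have hlast : a = b (Fin.last k) :=
      mul_right_cancel₀ hdet (ha.trans (det_mooreMatrixDelRow b hb))
    refine ⟨fun i => -b i.castSucc, fun j => ?_⟩
    have hj := hb j
    simp only [linearizedMap_apply, Fin.sum_univ_castSucc, Fin.val_castSucc, Fin.val_last] at hj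
    simp only [monicLinearizedMap_apply, neg_mul, Finset.sum_neg_distrib, hlast]
    linear_combination -hj

end

theorem Submodule.finrank_map_add_finrank_inf_ker {K V W : Type*} [Field K] [AddCommGroup V]
    [Module K V] [AddCommGroup W] [Module K W] [FiniteDimensional K V] (f : V →ₗ[K] W)
    (S : Submodule K V) :
    Module.finrank K (S.map f) + Module.finrank K ↥(S ⊓ LinearMap.ker f) =
      Module.finrank K S := by
  rw [← (f.domRestrict S).finrank_range_add_finrank_ker, LinearMap.range_domRestrict,
    LinearMap.ker_domRestrict, ← Submodule.finrank_map_subtype_eq,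
    Submodule.map_comap_subtype]

theorem exists_linearIndependent_fin_iff_le_finrank {K V : Type*} [Field K] [AddCommGroup V]
    [Module K V] [FiniteDimensional K V] (S : Submodule K V) (r : ℕ) :
    (∃ β : Fin r → V, LinearIndependent K β ∧ ∀ i, β i ∈ S) ↔ r ≤ Module.finrank K S := by
  constructor
  · rintro ⟨β, hβ, hS⟩
    have hle : Submodule.span K (Set.range β) ≤ S :=
      Submodule.span_le.mpr (Set.range_subset_iff.mpr hS)
    simpa [finrank_span_eq_card hβ] using Submodule.finrank_mono hle
  · intro h
    obtain ⟨β, hβ⟩ := exists_linearIndependent_of_le_finrank h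
    exact ⟨fun i => β i, hβ.map' S.subtype S.ker_subtype, fun i => (β i).2⟩

theorem rankDistTo_eq_iff {Fq F : Type} [Field Fq] [Field F] [Algebra Fq F] {n : ℕ}
    {u : Fin n → F} {G : Set (Fin n → F)} (hG : G.Nonempty) {r : ℕ}
    (hr : ∀ c ∈ G, r ≤ Module.finrank Fq (Submodule.span Fq (Set.range (u - c)))) :
    rankDistTo Fq u G = r ↔
      ∃ c ∈ G, Module.finrank Fq (Submodule.span Fq (Set.range (u - c))) ≤ r := by
  constructor
  · rintro rfl
    obtain ⟨c, hc⟩ := hG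
    obtain ⟨c', hc', h⟩ := Nat.sInf_mem (s := {r : ℕ | ∃ c ∈ G,
      r = Module.finrank Fq (Submodule.span Fq (Set.range (u - c)))}) ⟨_, c, hc, rfl⟩
    exact ⟨c', hc', h.ge⟩
  · rintro ⟨c, hc, h⟩
    refine le_antisymm (le_trans (Nat.sInf_le ⟨c, hc, rfl⟩) h) (le_csInf ⟨_, c, hc, rfl⟩ ?_)
    rintro _ ⟨c', hc', rfl⟩
    exact hr c' hc'

/-- Lemma 3: for `f(x) = x^{q^{k+1}} - a₁ x^{q^k} + (q-degree < k terms)`,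
`σ_f` is not a deep hole, i.e. `d_R(σ_f, G) = n - (k+1)`, iff there are `k+1` linearly
independent `β_1, …, β_{k+1}` in `⟨g_1, …, g_n⟩` with
`a₁ = det R_k(β) / det M_{k+1}(β)`. -/
theorem rank_not_deep_hole_iff_deg_k_add_one
    (q m n k : ℕ) (hq : IsPrimePow q) (hm : 0 < m) (hn : 0 < n) (hnm : n ≤ m)
    (Fq F : Type) [Field Fq] [Fintype Fq] [Field F] [Fintype F] [Algebra Fq F]
    (hcardFq : Fintype.card Fq = q) (hcardF : Fintype.card F = q ^ m)
    (g : Fin n → F) (hg : LinearIndependent Fq g)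
    (hk : 1 ≤ k) (hkn : k + 1 < n)
    (a₁ : F) (c : Fin k → F)
    (σf : Fin n → F)
    (hσf : σf = fun j =>
      g j ^ q ^ (k + 1) - a₁ * g j ^ q ^ k + ∑ i : Fin k, c i * g j ^ q ^ (i : ℕ)) :
    rankDistTo Fq σf (gabidulinCode q g k) = n - (k + 1) ↔
      ∃ β : Fin (k + 1) → F, LinearIndependent Fq β ∧
        (∀ i, β i ∈ Submodule.span Fq (Set.range g)) ∧
        a₁ = (mooreMatrixDelRow q k β).det / (mooreMatrix q β).det := by
  subst hcardFq
  let S := Submodule.span Fq (Set.range g)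
  have hS : Module.finrank Fq S = n := by simpa using finrank_span_eq_card hg
  have hspan (v : Fin k → F) : Submodule.span Fq (Set.range
      (σf - fun j => ∑ i : Fin k, v i * g j ^ Fintype.card Fq ^ (i : ℕ))) =
      S.map (monicLinearizedMap Fq a₁ (c - v)) := by
    rw [Submodule.map_span, ← Set.range_comp]
    congr 2
    ext j
    simp only [hσf, Pi.sub_apply, Function.comp_apply, monicLinearizedMap_apply, sub_mul,
      Finset.sum_sub_distrib]
    ring
  have hrank (v : Fin k → F) :=
    Submodule.finrank_map_add_finrank_inf_ker (monicLinearizedMap Fq a₁ (c - v)) S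
  have hdist : rankDistTo Fq σf (gabidulinCode (Fintype.card Fq) g k) = n - (k + 1) ↔
      ∃ v : Fin k → F, k + 1 ≤ Module.finrank Fq
        ↥(S ⊓ LinearMap.ker (monicLinearizedMap Fq a₁ (c - v))) := by
    have hG : (gabidulinCode (Fintype.card Fq) g k).Nonempty := ⟨_, 0, rfl⟩
    rw [rankDistTo_eq_iff hG]
    · constructor
      · rintro ⟨_, ⟨v, rfl⟩, h⟩
        rw [hspan] at h
        exact ⟨v, by have := hrank v; omega⟩
      · rintro ⟨v, h⟩
        refine ⟨_, ⟨v, rfl⟩, ?_⟩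
        rw [hspan]
        have := hrank v
        omega
    · rintro _ ⟨v, rfl⟩
      rw [hspan]
      have := hrank v
      have := (Submodule.finrank_mono (inf_le_right (a := S))).trans
        (finrank_ker_monicLinearizedMap_le (Fq := Fq) a₁ (c - v))
      omega
  simp only [hdist, ← exists_linearIndependent_fin_iff_le_finrank, Submodule.mem_inf,
    LinearMap.mem_ker]
  constructor
  · rintro ⟨v, β, hβ, h⟩
    exact ⟨β, hβ, fun i => (h i).1,
      (exists_monicLinearizedMap_eq_zero_iff hβ a₁).mp ⟨c - v, fun j => (h j).2⟩⟩
  · rintro ⟨β, hβ, hβS, h⟩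
    obtain ⟨d, hd⟩ := (exists_monicLinearizedMap_eq_zero_iff hβ a₁).mpr h
    exact ⟨c - d, β, hβ, fun i => ⟨hβS i, by simpa using hd i⟩⟩
end
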